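/- arXiv:2011.13543 — 8 statements merged into one kernel-verified Lean document; each statement's English description precedes it below -/
import Mathlib

section
/- Let F, G ∈ 𝓕(I) and x ∈ I. Then x is a jump of the composition G∘F if and only if either x is a jump of F, or F(x) is a singleton {y} with y a jump of G. -/
open Set Filter Topology

/-- Iterates of a multifunction: `Iter F 0 x = {x}`, `Iter F (n+1) x = F (Iter F n x)`. -/
def Iter (F : ℝ → Set ℝ) : ℕ → ℝ → Set ℝ
  | 0 => fun x => {x}
  | n + 1 => fun x => ⋃ y ∈ Iter F n x, F y

/-- Composition of multifunctions: `(G ∘ F)(x) = ⋃ y ∈ F x, G y`. -/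
def Comp (G F : ℝ → Set ℝ) : ℝ → Set ℝ := fun x => ⋃ y ∈ F x, G y

/-- Image of a set under a multifunction: `F(A) = ⋃ x ∈ A, F x`. -/
def ImageOf (F : ℝ → Set ℝ) (A : Set ℝ) : Set ℝ := ⋃ x ∈ A, F x

/-- `F` is a multifunction on `[a,b]`: nonempty compact values contained in `[a,b]`. -/
def MFOn (a b : ℝ) (F : ℝ → Set ℝ) : Prop :=
  ∀ x ∈ Icc a b, (F x).Nonempty ∧ IsCompact (F x) ∧ F x ⊆ Icc a b

/-- Upper semicontinuity of a multifunction at a point, relative to a domain `S`. -/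
def USCWithin (S : Set ℝ) (F : ℝ → Set ℝ) (x : ℝ) : Prop :=
  ∀ V : Set ℝ, IsOpen V → F x ⊆ V → ∃ U ∈ 𝓝 x, ∀ y ∈ U ∩ S, F y ⊆ V

/-- Upper semicontinuity on `[a,b]`. -/
def USCOn (a b : ℝ) (F : ℝ → Set ℝ) : Prop :=
  ∀ x ∈ Icc a b, USCWithin (Icc a b) F x

/-- Strictly increasing multifunction: `max F(x) < min F(y)` whenever `x < y` in `[a,b]`. -/
def SIncOn (a b : ℝ) (F : ℝ → Set ℝ) : Prop :=
  ∀ x ∈ Icc a b, ∀ y ∈ Icc a b, x < y → ∀ u ∈ F x, ∀ v ∈ F y, u < v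

/-- Strictly decreasing multifunction: `min F(x) > max F(y)` whenever `x < y` in `[a,b]`. -/
def SDecOn (a b : ℝ) (F : ℝ → Set ℝ) : Prop :=
  ∀ x ∈ Icc a b, ∀ y ∈ Icc a b, x < y → ∀ u ∈ F x, ∀ v ∈ F y, v < u

/-- The class 𝓕(I) of strictly monotone usc multifunctions on `I = [a,b]`. -/
def ClassF (a b : ℝ) (F : ℝ → Set ℝ) : Prop :=
  MFOn a b F ∧ USCOn a b F ∧ (SIncOn a b F ∨ SDecOn a b F)

/-- The set `J(F)` of jumps (set-valued points) of `F` in `[a,b]`. -/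
def Jumps (a b : ℝ) (F : ℝ → Set ℝ) : Set ℝ :=
  {x | x ∈ Icc a b ∧ (F x).Nontrivial}

/-- `k` is the intensity `ζ(F)`: the least `k` with `#J(F^k) = #J(F^{k+1})`. -/
def IsIntensity (a b : ℝ) (F : ℝ → Set ℝ) (k : ℕ) : Prop :=
  IsLeast {j : ℕ | (Jumps a b (Iter F j)).ncard = (Jumps a b (Iter F (j + 1))).ncard} k

/-- Exclusive multifunctions 𝓕₁(I): members of 𝓕(I) with finitely many jumps and intensity 1. -/
def Exclusive (a b : ℝ) (F : ℝ → Set ℝ) : Prop :=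
  ClassF a b F ∧ (Jumps a b F).Finite ∧ IsIntensity a b F 1

/-- Enumeration of the jumps: `c 0 = a`, `c (m+1) = b`, `c` strictly increasing on `{0,…,m+1}`,
and the jumps of `F` are exactly `c 1 < … < c m`.  The subintervals are `I_i = (c i, c (i+1))`. -/
def JumpEnum (a b : ℝ) (F : ℝ → Set ℝ) (m : ℕ) (c : ℕ → ℝ) : Prop :=
  c 0 = a ∧ c (m + 1) = b ∧ (∀ i j : ℕ, i < j → j ≤ m + 1 → c i < c j) ∧
    Jumps a b F = {x | ∃ i : ℕ, 1 ≤ i ∧ i ≤ m ∧ x = c i}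

/-- Hypothesis (H): `F` is strictly increasing, `max F(x) < x` on `(a,b)`, and `max F(b) ≤ b`. -/
def HypH (a b : ℝ) (F : ℝ → Set ℝ) : Prop :=
  SIncOn a b F ∧ (∀ x ∈ Ioo a b, ∀ u ∈ F x, u < x) ∧ (∀ u ∈ F b, u ≤ b)

/-- A strictly monotone multifunction takes disjoint values at distinct points. -/
theorem ClassF.ne_of_mem_of_ne {a b : ℝ} {G : ℝ → Set ℝ} (hG : ClassF a b G) {y z u v : ℝ}
    (hy : y ∈ Icc a b) (hz : z ∈ Icc a b) (hyz : y ≠ z) (hu : u ∈ G y) (hv : v ∈ G z) :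
    u ≠ v := by
  obtain ⟨-, -, hmono | hmono⟩ := hG <;> rcases hyz.lt_or_gt with h | h
  · exact (hmono y hy z hz h u hu v hv).ne
  · exact (hmono z hz y hy h v hv u hu).ne'
  · exact (hmono y hy z hz h u hu v hv).ne'
  · exact (hmono z hz y hy h v hv u hu).ne

/-- `x` is a jump of `G ∘ F` iff `x` is a jump of `F`, or `F x` is a singleton
`{y}` with `y` a jump of `G`. -/
theorem stmt1 (a b : ℝ) (hab : a < b) (F G : ℝ → Set ℝ)
    (hF : ClassF a b F) (hG : ClassF a b G) (x : ℝ) (hx : x ∈ Icc a b) :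
    x ∈ Jumps a b (Comp G F) ↔
      x ∈ Jumps a b F ∨ ∃ y : ℝ, F x = {y} ∧ y ∈ Jumps a b G := by
  obtain ⟨-, -, hsub⟩ := hF.1 x hx
  constructor
  · rintro ⟨-, u, hu, v, hv, huv⟩
    simp only [Comp, mem_iUnion, exists_prop] at hu hv
    obtain ⟨y, hy, hu⟩ := hu
    obtain ⟨z, hz, hv⟩ := hv
    rcases (F x).subsingleton_or_nontrivial with hs | hn
    · obtain rfl : y = z := hs hy hz
      exact Or.inr ⟨y, hs.eq_singleton_of_mem hy, hsub hy, u, hu, v, hv, huv⟩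
    · exact Or.inl ⟨hx, hn⟩
  · rintro (⟨-, y, hy, z, hz, hyz⟩ | ⟨y, hxy, -, hn⟩)
    · obtain ⟨u, hu⟩ := (hG.1 y (hsub hy)).1
      obtain ⟨v, hv⟩ := (hG.1 z (hsub hz)).1
      exact ⟨hx, u, mem_biUnion hy hu, v, mem_biUnion hz hv,
        hG.ne_of_mem_of_ne (hsub hy) (hsub hz) hyz hu hv⟩
    · exact ⟨hx, by simpa [Comp, hxy] using hn⟩
end

section
/- Let F ∈ 𝓕(I) have finitely many jumps and assume the intensity ζ(F) is finite. Then J(F^(ζ(F))) = J(F^(ζ(F)+i)) for every positive integer i. -/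
open Set Filter Topology

lemma ClassF.eq_of_mem_of_mem {a b : ℝ} {F : ℝ → Set ℝ} (hF : ClassF a b F) {x y u : ℝ}
    (hx : x ∈ Icc a b) (hy : y ∈ Icc a b) (hux : u ∈ F x) (huy : u ∈ F y) : x = y := by
  rcases hF.2.2 with h | h <;> rcases lt_trichotomy x y with hxy | hxy | hxy
  · exact absurd (h x hx y hy hxy u hux u huy) (lt_irrefl u)
  · exact hxy
  · exact absurd (h y hy x hx hxy u huy u hux) (lt_irrefl u)
  · exact absurd (h x hx y hy hxy u hux u huy) (lt_irrefl u)
  · exact hxy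
  · exact absurd (h y hy x hx hxy u huy u hux) (lt_irrefl u)

lemma Iter_succ_eq_biUnion (F : ℝ → Set ℝ) (n : ℕ) (x : ℝ) :
    Iter F (n + 1) x = ⋃ y ∈ F x, Iter F n y := by
  induction n with
  | zero => simp [Iter]
  | succ n ih =>
    change (⋃ y ∈ Iter F (n + 1) x, F y) = _
    rw [ih]
    ext z
    simp only [Iter, mem_iUnion, exists_prop]
    grind

lemma ClassF.Iter_subset {a b : ℝ} {F : ℝ → Set ℝ} (hF : ClassF a b F) (n : ℕ) {x : ℝ}
    (hx : x ∈ Icc a b) : Iter F n x ⊆ Icc a b := by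
  induction n with
  | zero => simpa [Iter] using hx
  | succ n ih => exact iUnion₂_subset fun y hy => (hF.1 y (ih hy)).2.2

lemma ClassF.Jumps_Iter_subset_succ {a b : ℝ} {F : ℝ → Set ℝ} (hF : ClassF a b F) (n : ℕ) :
    Jumps a b (Iter F n) ⊆ Jumps a b (Iter F (n + 1)) := by
  rintro x ⟨hx, y, hy, z, hz, hyz⟩
  have hyI := hF.Iter_subset n hx hy
  have hzI := hF.Iter_subset n hx hz
  obtain ⟨u, hu⟩ := (hF.1 y hyI).1
  obtain ⟨v, hv⟩ := (hF.1 z hzI).1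
  refine ⟨hx, u, mem_biUnion hy hu, v, mem_biUnion hz hv, ?_⟩
  rintro rfl
  exact hyz (hF.eq_of_mem_of_mem hyI hzI hu hv)

lemma ClassF.Jumps_subset_Iter_succ {a b : ℝ} {F : ℝ → Set ℝ} (hF : ClassF a b F) (n : ℕ) :
    Jumps a b F ⊆ Jumps a b (Iter F (n + 1)) := by
  induction n with
  | zero =>
    rintro x ⟨hx, h⟩
    exact ⟨hx, by simpa [Iter] using h⟩
  | succ n ih => exact ih.trans (hF.Jumps_Iter_subset_succ (n + 1))

/-- A jump of `F^(n+1)` is a jump of `F` or is mapped by `F` to a single jump of `F^n`. -/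
lemma ClassF.mem_Jumps_Iter_succ {a b : ℝ} {F : ℝ → Set ℝ} (hF : ClassF a b F) {n : ℕ} {x : ℝ}
    (h : x ∈ Jumps a b (Iter F (n + 1))) :
    x ∈ Jumps a b F ∨ ∃ y ∈ Jumps a b (Iter F n), F x = {y} := by
  obtain ⟨hx, hn⟩ := h
  rcases (F x).subsingleton_or_nontrivial with hs | ht
  · obtain ⟨y, hy⟩ := (hF.1 x hx).1
    have hFx : F x = {y} := hs.eq_singleton_of_mem hy
    rw [Iter_succ_eq_biUnion, hFx, biUnion_singleton] at hn
    exact Or.inr ⟨y, ⟨(hF.1 x hx).2.2 hy, hn⟩, hFx⟩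
  · exact Or.inl ⟨hx, ht⟩

lemma ClassF.finite_Jumps_Iter {a b : ℝ} {F : ℝ → Set ℝ} (hF : ClassF a b F)
    (hfin : (Jumps a b F).Finite) (n : ℕ) : (Jumps a b (Iter F n)).Finite := by
  induction n with
  | zero => simp [Jumps, Iter]
  | succ n ih =>
    have hpre : (⋃ y ∈ Jumps a b (Iter F n), {x | x ∈ Icc a b ∧ y ∈ F x}).Finite :=
      ih.biUnion fun y _ => Set.Subsingleton.finite fun x hx z hz =>
        hF.eq_of_mem_of_mem hx.1 hz.1 hx.2 hz.2
    refine (hfin.union hpre).subset fun x hx => ?_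
    rcases hF.mem_Jumps_Iter_succ hx with h | ⟨y, hy, hxy⟩
    · exact Or.inl h
    · exact Or.inr (mem_biUnion hy ⟨hx.1, by simp [hxy]⟩)

lemma ClassF.Jumps_Iter_succ_eq {a b : ℝ} {F : ℝ → Set ℝ} (hF : ClassF a b F) {n : ℕ}
    (h : Jumps a b (Iter F n) = Jumps a b (Iter F (n + 1))) :
    Jumps a b (Iter F (n + 1)) = Jumps a b (Iter F (n + 2)) := by
  refine (hF.Jumps_Iter_subset_succ (n + 1)).antisymm fun x hx => ?_
  rcases hF.mem_Jumps_Iter_succ hx with hJ | ⟨y, hy, hxy⟩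
  · exact hF.Jumps_subset_Iter_succ n hJ
  · rw [← h] at hy
    refine ⟨hx.1, ?_⟩
    rw [Iter_succ_eq_biUnion, hxy, biUnion_singleton]
    exact hy.2

/-- if the intensity `ζ(F) = k` is finite then `J(F^k) = J(F^{k+i})` for all
positive integers `i`. -/
theorem stmt2 (a b : ℝ) (hab : a < b) (F : ℝ → Set ℝ) (hF : ClassF a b F)
    (hfin : (Jumps a b F).Finite) (k : ℕ) (hk : IsIntensity a b F k) :
    ∀ i : ℕ, 1 ≤ i → Jumps a b (Iter F k) = Jumps a b (Iter F (k + i)) := by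
  have hJ : ∀ i, Jumps a b (Iter F (k + i)) = Jumps a b (Iter F (k + i + 1)) := by
    intro i
    induction i with
    | zero =>
      exact Set.eq_of_subset_of_ncard_le (hF.Jumps_Iter_subset_succ k) hk.1.ge
        (hF.finite_Jumps_Iter hfin (k + 1))
    | succ i ih => exact hF.Jumps_Iter_succ_eq ih
  intro i _
  induction i with
  | zero => rfl
  | succ i ih =>
    rcases Nat.eq_zero_or_pos i with rfl | hi
    · exact hJ 0
    · exact (ih hi).trans (hJ i)
end

section
/- Let F ∈ 𝓕(I) have finitely many jumps and assume the intensity ζ(F) is finite. Then for every positive integer i, the intensity of the i-th iterate satisfies ζ(F^i) = ⌈ζ(F)/i⌉ (the least integer not less than ζ(F)/i). -/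
open Set Filter Topology

theorem mem_iter_succ {F : ℝ → Set ℝ} {n : ℕ} {x u : ℝ} :
    u ∈ Iter F (n + 1) x ↔ ∃ y ∈ Iter F n x, u ∈ F y := by
  simp [Iter]

theorem mem_iter_one {F : ℝ → Set ℝ} {x u : ℝ} : u ∈ Iter F 1 x ↔ u ∈ F x := by
  simp [Iter]

theorem mem_iter_add {F : ℝ → Set ℝ} {m n : ℕ} {x u : ℝ} :
    u ∈ Iter F (m + n) x ↔ ∃ y ∈ Iter F m x, u ∈ Iter F n y := by
  induction n generalizing u with
  | zero => simp [Iter]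
  | succ n ih =>
    rw [← add_assoc, mem_iter_succ]
    constructor
    · rintro ⟨z, hz, hu⟩
      obtain ⟨y, hy, hzy⟩ := ih.1 hz
      exact ⟨y, hy, mem_iter_succ.2 ⟨z, hzy, hu⟩⟩
    · rintro ⟨y, hy, hu⟩
      obtain ⟨z, hzy, hu⟩ := mem_iter_succ.1 hu
      exact ⟨z, ih.2 ⟨y, hy, hzy⟩, hu⟩

theorem iter_iter (F : ℝ → Set ℝ) (i j : ℕ) : Iter (Iter F i) j = Iter F (i * j) := by
  induction j with
  | zero => rfl
  | succ j ih =>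
    ext x u
    rw [mem_iter_succ, ih, Nat.mul_succ, mem_iter_add]

/-- Nonempty-valued self-multifunctions of `[a,b]` with pairwise disjoint values. -/
structure DisjointValued (a b : ℝ) (F : ℝ → Set ℝ) : Prop where
  nonempty : ∀ x ∈ Icc a b, (F x).Nonempty
  subset : ∀ x ∈ Icc a b, F x ⊆ Icc a b
  eq_of_mem : ∀ x ∈ Icc a b, ∀ y ∈ Icc a b, ∀ u, u ∈ F x → u ∈ F y → x = y

theorem ClassF.disjointValued {a b : ℝ} {F : ℝ → Set ℝ} (hF : ClassF a b F) :
    DisjointValued a b F := by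
  obtain ⟨hM, -, hmono⟩ := hF
  refine ⟨fun x hx => (hM x hx).1, fun x hx => (hM x hx).2.2, fun x hx y hy u hux huy => ?_⟩
  by_contra hne
  rcases hmono with h | h <;> rcases lt_or_gt_of_ne hne with hlt | hlt
  · exact lt_irrefl u (h x hx y hy hlt u hux u huy)
  · exact lt_irrefl u (h y hy x hx hlt u huy u hux)
  · exact lt_irrefl u (h x hx y hy hlt u hux u huy)
  · exact lt_irrefl u (h y hy x hx hlt u huy u hux)

namespace DisjointValued

variable {a b : ℝ} {F : ℝ → Set ℝ}

theorem iter (h : DisjointValued a b F) (n : ℕ) : DisjointValued a b (Iter F n) := by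
  induction n with
  | zero =>
    refine ⟨fun x _ => singleton_nonempty x, fun x hx => singleton_subset_iff.2 hx, ?_⟩
    intro x _ y _ u hux huy
    exact (show u = x from hux).symm.trans huy
  | succ n ih =>
    refine ⟨fun x hx => ?_, fun x hx u hu => ?_, fun x hx y hy u hux huy => ?_⟩
    · obtain ⟨y, hy⟩ := ih.nonempty x hx
      obtain ⟨u, hu⟩ := h.nonempty y (ih.subset x hx hy)
      exact ⟨u, mem_iter_succ.2 ⟨y, hy, hu⟩⟩
    · obtain ⟨y, hy, hu⟩ := mem_iter_succ.1 hu
      exact h.subset y (ih.subset x hx hy) hu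
    · obtain ⟨z, hz, huz⟩ := mem_iter_succ.1 hux
      obtain ⟨w, hw, huw⟩ := mem_iter_succ.1 huy
      obtain rfl := h.eq_of_mem z (ih.subset x hx hz) w (ih.subset y hy hw) u huz huw
      exact ih.eq_of_mem x hx y hy z hz hw

theorem jumps_iter_subset_add (h : DisjointValued a b F) (m n : ℕ) :
    Jumps a b (Iter F m) ⊆ Jumps a b (Iter F (m + n)) := by
  rintro x ⟨hx, y, hy, z, hz, hne⟩
  have hyI := (h.iter m).subset x hx hy
  have hzI := (h.iter m).subset x hx hz
  obtain ⟨u, hu⟩ := (h.iter n).nonempty y hyI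
  obtain ⟨v, hv⟩ := (h.iter n).nonempty z hzI
  refine ⟨hx, u, mem_iter_add.2 ⟨y, hy, hu⟩, v, mem_iter_add.2 ⟨z, hz, hv⟩, ?_⟩
  rintro rfl
  exact hne ((h.iter n).eq_of_mem y hyI z hzI u hu hv)

theorem jumps_iter_mono (h : DisjointValued a b F) :
    Monotone fun n => Jumps a b (Iter F n) := by
  intro m n hmn
  obtain ⟨d, rfl⟩ := Nat.exists_eq_add_of_le hmn
  exact h.jumps_iter_subset_add m d

/-- A new jump of `F^(m+n)` is carried by `F^m` to a jump of `F^n`. -/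
theorem exists_mem_jumps (h : DisjointValued a b F) {m n : ℕ} {x : ℝ}
    (hx : x ∈ Jumps a b (Iter F (m + n))) (hxm : x ∉ Jumps a b (Iter F m)) :
    ∃ y ∈ Iter F m x, y ∈ Jumps a b (Iter F n) := by
  obtain ⟨hxI, u, hu, v, hv, hne⟩ := hx
  obtain ⟨y, hy, huy⟩ := mem_iter_add.1 hu
  obtain ⟨z, hz, hvz⟩ := mem_iter_add.1 hv
  have hyz : y = z := by
    by_contra hyz
    exact hxm ⟨hxI, y, hy, z, hz, hyz⟩
  subst hyz
  exact ⟨y, hy, (h.iter m).subset x hxI hy, u, huy, v, hvz, hne⟩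

theorem finite_jumps_iter (h : DisjointValued a b F) (hfin : (Jumps a b F).Finite) (n : ℕ) :
    (Jumps a b (Iter F n)).Finite := by
  induction n with
  | zero =>
    refine Set.finite_empty.subset ?_
    rintro x ⟨-, hx⟩
    exact (not_nontrivial_singleton hx).elim
  | succ n ih =>
    have hone : Iter F 1 = F := by
      ext x u
      exact mem_iter_one
    have hpre : (⋃ y ∈ Jumps a b F, {x | x ∈ Icc a b ∧ y ∈ Iter F n x}).Finite := by
      refine hfin.biUnion fun y _ => Set.Subsingleton.finite ?_
      rintro x ⟨hx, hyx⟩ z ⟨hz, hyz⟩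
      exact (h.iter n).eq_of_mem x hx z hz y hyx hyz
    refine (ih.union hpre).subset fun x hx => ?_
    by_cases hxn : x ∈ Jumps a b (Iter F n)
    · exact Or.inl hxn
    · obtain ⟨y, hy, hyJ⟩ := h.exists_mem_jumps hx hxn
      rw [hone] at hyJ
      exact Or.inr (mem_biUnion hyJ ⟨hx.1, hy⟩)

theorem jumps_iter_succ_eq (h : DisjointValued a b F) {k : ℕ}
    (hk : Jumps a b (Iter F k) = Jumps a b (Iter F (k + 1))) :
    Jumps a b (Iter F (k + 1)) = Jumps a b (Iter F (k + 1 + 1)) := by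
  refine (h.jumps_iter_subset_add (k + 1) 1).antisymm fun x hx => ?_
  by_cases hx1 : x ∈ Jumps a b (Iter F 1)
  · exact h.jumps_iter_mono (Nat.le_add_left 1 k) hx1
  · rw [add_comm (k + 1) 1] at hx
    obtain ⟨z, hz, hzJ⟩ := h.exists_mem_jumps hx hx1
    rw [← hk] at hzJ
    obtain ⟨-, u, hu, v, hv, hne⟩ := hzJ
    rw [add_comm k 1]
    exact ⟨hx.1, u, mem_iter_add.2 ⟨z, hz, hu⟩, v, mem_iter_add.2 ⟨z, hz, hv⟩, hne⟩

theorem jumps_iter_eq_of_le (h : DisjointValued a b F) {k n : ℕ}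
    (hk : Jumps a b (Iter F k) = Jumps a b (Iter F (k + 1))) (hn : k ≤ n) :
    Jumps a b (Iter F n) = Jumps a b (Iter F k) := by
  have hstep : ∀ m ≥ k, Jumps a b (Iter F m) = Jumps a b (Iter F (m + 1)) := by
    intro m hm
    induction m, hm using Nat.le_induction with
    | base => exact hk
    | succ m _ ih => exact h.jumps_iter_succ_eq ih
  induction n, hn using Nat.le_induction with
  | base => rfl
  | succ n hn ih => exact (hstep n hn).symm.trans ih

theorem ncard_jumps_iter_eq_iff (h : DisjointValued a b F) (hfin : (Jumps a b F).Finite)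
    {m n : ℕ} (hmn : m ≤ n) :
    (Jumps a b (Iter F m)).ncard = (Jumps a b (Iter F n)).ncard ↔
      Jumps a b (Iter F m) = Jumps a b (Iter F n) :=
  ⟨fun he => eq_of_subset_of_ncard_le (h.jumps_iter_mono hmn) he.ge (h.finite_jumps_iter hfin n),
    fun he => by rw [he]⟩

/-- The number of jumps is the same for two different iterates exactly when the lower of them
has order at least the intensity. -/
theorem ncard_jumps_iter_eq_iff_le (h : DisjointValued a b F) (hfin : (Jumps a b F).Finite)
    {k : ℕ} (hk : IsIntensity a b F k) {m n : ℕ} (hmn : m < n) :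
    (Jumps a b (Iter F m)).ncard = (Jumps a b (Iter F n)).ncard ↔ k ≤ m := by
  rw [h.ncard_jumps_iter_eq_iff hfin hmn.le]
  constructor
  · intro he
    refine hk.2 ((h.ncard_jumps_iter_eq_iff hfin m.le_succ).2 ?_)
    refine (h.jumps_iter_mono m.le_succ).antisymm ?_
    exact (h.jumps_iter_mono hmn).trans he.ge
  · intro hkm
    have hk' := (h.ncard_jumps_iter_eq_iff hfin k.le_succ).1 hk.1
    rw [h.jumps_iter_eq_of_le hk' hkm, h.jumps_iter_eq_of_le hk' (hkm.trans hmn.le)]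

end DisjointValued

/-- if the intensity `ζ(F) = k` is finite, then for every positive integer `i`
the intensity of `F^i` is `⌈k / i⌉ = (k + i - 1) / i`. -/
theorem stmt3 (a b : ℝ) (hab : a < b) (F : ℝ → Set ℝ) (hF : ClassF a b F)
    (hfin : (Jumps a b F).Finite) (k : ℕ) (hk : IsIntensity a b F k) :
    ∀ i : ℕ, 1 ≤ i → IsIntensity a b (Iter F i) ((k + i - 1) / i) := by
  intro i hi
  have h := hF.disjointValued
  have key : ∀ j : ℕ, (Jumps a b (Iter (Iter F i) j)).ncard =
      (Jumps a b (Iter (Iter F i) (j + 1))).ncard ↔ (k + i - 1) / i ≤ j := by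
    intro j
    rw [iter_iter, iter_iter, h.ncard_jumps_iter_eq_iff_le hfin hk
      (Nat.mul_lt_mul_of_pos_left j.lt_succ_self hi), ← Nat.lt_succ_iff (n := j),
      Nat.div_lt_iff_lt_mul hi, Nat.succ_mul, mul_comm j i]
    omega
  exact ⟨(key _).2 le_rfl, fun j hj => (key j).1 hj⟩
end

section
/- Let F ∈ 𝓕₁(I). Then for every i ∈ {0,1,…,m} there exists j ∈ {0,1,…,m} such that F(I_i) ⊆ I_j. -/
open Set Filter Topology

/-- The first iterate of a multifunction is the multifunction itself. -/
theorem iter_one (F : ℝ → Set ℝ) : Iter F 1 = F := by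
  funext x
  simp [Iter]

/-- The second iterate of a multifunction is its composition with itself. -/
theorem iter_two_apply (F : ℝ → Set ℝ) (x : ℝ) : Iter F 2 x = ⋃ y ∈ F x, F y := by
  simp [Iter]

/-- Values of a strictly monotone multifunction at distinct points are disjoint. -/
theorem ClassF.ne_of_ne {a b : ℝ} {F : ℝ → Set ℝ} (hF : ClassF a b F) {x y u v : ℝ}
    (hx : x ∈ Icc a b) (hy : y ∈ Icc a b) (hxy : x ≠ y) (hu : u ∈ F x) (hv : v ∈ F y) :
    u ≠ v := by
  obtain ⟨-, -, h | h⟩ := hF <;> rcases hxy.lt_or_gt with hlt | hlt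
  · exact (h x hx y hy hlt u hu v hv).ne
  · exact (h y hy x hx hlt v hv u hu).ne'
  · exact (h x hx y hy hlt u hu v hv).ne'
  · exact (h y hy x hx hlt v hv u hu).ne

/-- A strictly monotone multifunction maps interior points to interior points. -/
theorem ClassF.mem_Ioo {a b : ℝ} {F : ℝ → Set ℝ} (hF : ClassF a b F) {x u : ℝ}
    (hx : x ∈ Ioo a b) (hu : u ∈ F x) : u ∈ Ioo a b := by
  have hab : a ≤ b := (hx.1.trans hx.2).le
  have ha : a ∈ Icc a b := left_mem_Icc.2 hab
  have hb : b ∈ Icc a b := right_mem_Icc.2 hab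
  have hx' : x ∈ Icc a b := Ioo_subset_Icc_self hx
  obtain ⟨hM, -, h⟩ := hF
  obtain ⟨v, hv⟩ := (hM a ha).1
  obtain ⟨w, hw⟩ := (hM b hb).1
  have hvI := (hM a ha).2.2 hv
  have hwI := (hM b hb).2.2 hw
  rcases h with h | h
  · exact ⟨hvI.1.trans_lt (h a ha x hx' hx.1 v hv u hu),
      (h x hx' b hb hx.2 u hu w hw).trans_le hwI.2⟩
  · exact ⟨hwI.1.trans_lt (h x hx' b hb hx.2 u hu w hw),
      (h a ha x hx' hx.1 v hv u hu).trans_le hvI.2⟩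

theorem ClassF.jumps_subset_jumps_iter_two {a b : ℝ} {F : ℝ → Set ℝ} (hF : ClassF a b F) :
    Jumps a b F ⊆ Jumps a b (Iter F 2) := by
  rintro x ⟨hx, u, hu, v, hv, huv⟩
  have huI := (hF.1 x hx).2.2 hu
  have hvI := (hF.1 x hx).2.2 hv
  obtain ⟨p, hp⟩ := (hF.1 u huI).1
  obtain ⟨q, hq⟩ := (hF.1 v hvI).1
  rw [Jumps, mem_ofPred_eq, iter_two_apply]
  exact ⟨hx, p, mem_biUnion hu hp, q, mem_biUnion hv hq, hF.ne_of_ne huI hvI huv hp hq⟩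

/-- An exclusive multifunction and its second iterate have the same jumps. -/
theorem Exclusive.jumps_iter_two {a b : ℝ} {F : ℝ → Set ℝ} (hF : Exclusive a b F) :
    Jumps a b (Iter F 2) = Jumps a b F := by
  obtain ⟨hC, hfin, hI⟩ := hF
  have hcard : (Jumps a b (Iter F 1)).ncard = (Jumps a b (Iter F 2)).ncard := hI.1
  rw [iter_one] at hcard
  by_cases h2 : (Jumps a b (Iter F 2)).Finite
  · exact (eq_of_subset_of_ncard_le hC.jumps_subset_jumps_iter_two hcard.ge h2).symm
  · rw [Set.Infinite.ncard h2, ncard_eq_zero hfin] at hcard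
    refine absurd ?_ h2
    suffices Jumps a b (Iter F 2) = ∅ by rw [this]; exact finite_empty
    refine eq_empty_of_forall_notMem ?_
    rintro x ⟨hx, hnt⟩
    have hsub : ∀ y ∈ Icc a b, (F y).Subsingleton := fun y hy =>
      not_nontrivial_iff.1 fun h => (hcard.subset ⟨hy, h⟩ : y ∈ (∅ : Set ℝ))
    rw [iter_two_apply] at hnt
    obtain ⟨p, hp, q, hq, hpq⟩ := hnt
    obtain ⟨u, hu, hp⟩ := mem_iUnion₂.1 hp
    obtain ⟨v, hv, hq⟩ := mem_iUnion₂.1 hq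
    obtain rfl := hsub x hx hu hv
    exact hpq (hsub u ((hC.1 x hx).2.2 hu) hp hq)

/-- An exclusive multifunction maps non-jumps to non-jumps. -/
theorem Exclusive.notMem_jumps {a b : ℝ} {F : ℝ → Set ℝ} (hF : Exclusive a b F) {x u : ℝ}
    (hx : x ∈ Icc a b) (hxJ : x ∉ Jumps a b F) (hu : u ∈ F x) : u ∉ Jumps a b F := by
  rintro ⟨-, hnt⟩
  rw [← hF.jumps_iter_two] at hxJ
  refine hxJ ⟨hx, ?_⟩
  rw [iter_two_apply]
  exact hnt.mono (subset_biUnion_of_mem hu)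

/-- A single-valued selection of an upper semicontinuous multifunction is continuous. -/
theorem USCOn.continuousOn {a b : ℝ} {F : ℝ → Set ℝ} (hF : USCOn a b F) {S : Set ℝ}
    (hS : S ⊆ Icc a b) {f : ℝ → ℝ} (hf : ∀ x ∈ S, F x = {f x}) : ContinuousOn f S := by
  intro x hx
  refine tendsto_nhds.2 fun V hV hxV => ?_
  obtain ⟨U, hU, h⟩ := hF x (hS hx) V hV (by rw [hf x hx]; exact singleton_subset_iff.2 hxV)
  filter_upwards [mem_nhdsWithin_of_mem_nhds hU, self_mem_nhdsWithin] with y hyU hyS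
  have hy := h y ⟨hyU, hS hyS⟩
  rw [hf y hyS] at hy
  exact hy rfl

theorem JumpEnum.Ioo_subset {a b : ℝ} {F : ℝ → Set ℝ} {m : ℕ} {c : ℕ → ℝ}
    (hc : JumpEnum a b F m c) {i : ℕ} (hi : i ≤ m) : Ioo (c i) (c (i + 1)) ⊆ Ioo a b := by
  obtain ⟨h0, h1, hlt, -⟩ := hc
  refine Ioo_subset_Ioo ?_ ?_
  · rcases Nat.eq_zero_or_pos i with rfl | hpos
    · exact h0.ge
    · exact h0 ▸ (hlt 0 i hpos (by omega)).le
  · rcases hi.eq_or_lt with rfl | hlt'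
    · exact h1.le
    · exact h1 ▸ (hlt (i + 1) (m + 1) (by omega) le_rfl).le

theorem JumpEnum.notMem_jumps {a b : ℝ} {F : ℝ → Set ℝ} {m : ℕ} {c : ℕ → ℝ}
    (hc : JumpEnum a b F m c) {i : ℕ} (hi : i ≤ m) {x : ℝ} (hx : x ∈ Ioo (c i) (c (i + 1))) :
    x ∉ Jumps a b F := by
  obtain ⟨-, -, hlt, hJ⟩ := hc
  rw [hJ]
  rintro ⟨k, -, hkm, rfl⟩
  rcases lt_trichotomy k i with h | rfl | h
  · exact (hlt k i h (by omega)).not_gt hx.1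
  · exact lt_irrefl _ hx.1
  · rcases (Nat.succ_le_of_lt h).eq_or_lt with rfl | h'
    · exact lt_irrefl _ hx.2
    · exact (hlt (i + 1) k h' (by omega)).not_gt hx.2

/-- The intervals between consecutive jumps are the components of the complement of the jumps:
a preconnected set of interior non-jumps lies in one of them. -/
theorem JumpEnum.exists_subset_Ioo {a b : ℝ} {F : ℝ → Set ℝ} {m : ℕ} {c : ℕ → ℝ}
    (hc : JumpEnum a b F m c) {S : Set ℝ} (hS : IsPreconnected S) (hab : S ⊆ Ioo a b)
    (hJS : ∀ x ∈ S, x ∉ Jumps a b F) : ∃ j ≤ m, S ⊆ Ioo (c j) (c (j + 1)) := by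
  obtain ⟨h0, h1, -, hJ⟩ := hc
  have hcS : ∀ k ≤ m + 1, c k ∉ S := by
    intro k hk hkS
    by_cases hk0 : k = 0
    · subst hk0
      exact (hab hkS).1.ne' h0
    by_cases hkm : k = m + 1
    · subst hkm
      exact (hab hkS).2.ne h1
    exact hJS _ hkS (hJ ▸ ⟨k, by omega, by omega, rfl⟩)
  rcases S.eq_empty_or_nonempty with rfl | ⟨y, hy⟩
  · exact ⟨0, Nat.zero_le _, empty_subset _⟩
  classical
  set j := Nat.findGreatest (fun k => c k < y) m with hj
  have hjm : j ≤ m := Nat.findGreatest_le m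
  have hjy : c j < y :=
    Nat.findGreatest_spec (P := fun k => c k < y) (Nat.zero_le m) (h0 ▸ (hab hy).1)
  have hyj : y < c (j + 1) := by
    rcases hjm.eq_or_lt with h | h
    · rw [h, h1]
      exact (hab hy).2
    · have hle : y ≤ c (j + 1) :=
        not_lt.1 (Nat.findGreatest_is_greatest (P := fun k => c k < y) (Nat.lt_succ_self j) h)
      exact hle.lt_of_ne fun e => hcS (j + 1) (by omega) (e ▸ hy)
  refine ⟨j, hjm, fun z hz => ⟨?_, ?_⟩⟩
  · by_contra! hzj
    exact hcS j (by omega) (hS.ordConnected.out hz hy ⟨hzj, hjy.le⟩)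
  · by_contra! hzj
    exact hcS (j + 1) (by omega) (hS.ordConnected.out hy hz ⟨hyj.le, hzj⟩)

/-- for `F ∈ 𝓕₁(I)`, every subinterval `I_i` is mapped by `F` into some
subinterval `I_j`. -/
theorem stmt4 (a b : ℝ) (hab : a < b) (F : ℝ → Set ℝ) (hF : Exclusive a b F)
    (m : ℕ) (c : ℕ → ℝ) (hc : JumpEnum a b F m c) :
    ∀ i ≤ m, ∃ j ≤ m,
      ImageOf F (Ioo (c i) (c (i + 1))) ⊆ Ioo (c j) (c (j + 1)) := by
  intro i hi
  have hsub := hc.Ioo_subset hi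
  have hsub' : Ioo (c i) (c (i + 1)) ⊆ Icc a b := hsub.trans Ioo_subset_Icc_self
  have hsingle : ∀ x ∈ Ioo (c i) (c (i + 1)), ∃ y, F x = {y} := fun x hx =>
    exists_eq_singleton_iff_nonempty_subsingleton.2 ⟨(hF.1.1 x (hsub' hx)).1,
      not_nontrivial_iff.1 fun h => hc.notMem_jumps hi hx ⟨hsub' hx, h⟩⟩
  choose! f hf using hsingle
  have himage : ImageOf F (Ioo (c i) (c (i + 1))) = f '' Ioo (c i) (c (i + 1)) := by
    rw [ImageOf, iUnion₂_congr hf, image_eq_iUnion]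
  refine hc.exists_subset_Ioo ?_ ?_ ?_
  · rw [himage]
    exact isPreconnected_Ioo.image f (hF.1.2.1.continuousOn hsub' hf)
  · exact iUnion₂_subset fun x hx u hu => hF.1.mem_Ioo (hsub hx) hu
  · intro u hu
    obtain ⟨x, hx, hu⟩ := mem_iUnion₂.1 hu
    exact hF.notMem_jumps (hsub' hx) (hc.notMem_jumps hi hx) hu
end

section
/- Suppose F ∈ 𝓕₁(I) is strictly increasing. Then there is a subinterval I' ∈ I(F) such that F(I') ⊆ I'. -/
open Set Filter Topology

/-- a strictly increasing `F ∈ 𝓕₁(I)` has a subinterval `I' ∈ I(F)` with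
`F(I') ⊆ I'`. -/
theorem stmt5 (a b : ℝ) (hab : a < b) (F : ℝ → Set ℝ) (hF : Exclusive a b F)
    (hinc : SIncOn a b F) (m : ℕ) (c : ℕ → ℝ) (hc : JumpEnum a b F m c) :
    ∃ i ≤ m, ImageOf F (Ioo (c i) (c (i + 1))) ⊆ Ioo (c i) (c (i + 1)) := by
  obtain ⟨hc0, hcm, hmono, -⟩ := hc
  obtain ⟨⟨hMF, -, -⟩, -, -⟩ := hF
  have hle : ∀ i j : ℕ, i ≤ j → j ≤ m + 1 → c i ≤ c j := fun i j hij hj =>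
    hij.eq_or_lt.elim (fun h => h ▸ le_rfl) fun h => (hmono i j h hj).le
  have hI : ∀ i ≤ m, ∀ x ∈ Ioo (c i) (c (i + 1)), x ∈ Ioo a b := fun i hi x hx =>
    ⟨hc0 ▸ (hle 0 i i.zero_le (by lia)).trans_lt hx.1,
      hcm ▸ hx.2.trans_le (hle (i + 1) (m + 1) (by lia) le_rfl)⟩
  by_contra! hne
  have key : ∀ i ≤ m, ∀ x ∈ Ioo (c i) (c (i + 1)), ∀ u ∈ F x, c i < u := by
    intro i
    induction i with
    | zero =>
      intro hi x hx u hu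
      obtain ⟨v, hv⟩ := (hMF a (left_mem_Icc.2 hab.le)).1
      have hxI := hI 0 hi x hx
      rw [hc0]
      exact ((hMF a (left_mem_Icc.2 hab.le)).2.2 hv).1.trans_lt
        (hinc a (left_mem_Icc.2 hab.le) x (Ioo_subset_Icc_self hxI) hxI.1 v hv u hu)
    | succ i ih =>
      intro hi x hx u hu
      by_contra! hux
      refine hne i (by lia) (iUnion₂_subset fun y hy w hw => ⟨ih (by lia) y hy w hw, ?_⟩)
      exact (hinc y (Ioo_subset_Icc_self (hI i (by lia) y hy)) x
        (Ioo_subset_Icc_self (hI (i + 1) hi x hx)) (hy.2.trans hx.1) w hw u hu).trans_le hux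
  refine hne m le_rfl (iUnion₂_subset fun y hy w hw => ⟨key m le_rfl y hy w hw, ?_⟩)
  obtain ⟨v, hv⟩ := (hMF b (right_mem_Icc.2 hab.le)).1
  have hyI := hI m le_rfl y hy
  rw [hcm]
  exact (hinc y (Ioo_subset_Icc_self hyI) b (right_mem_Icc.2 hab.le) hyI.2 w hw v hv).trans_le
    ((hMF b (right_mem_Icc.2 hab.le)).2.2 hv).2
end

section
/- Let F ∈ 𝓕₁(I) and let f ∈ 𝓕(I) be a strictly increasing iterative root of F of order n ≥ 1. If there exists c ∈ (a,b) such that c ∈ F(c), then c ∈ f(c). -/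
open Set Filter Topology

/-- Iterates of a multifunction on `[a,b]` stay in `[a,b]`. -/
theorem iter_subset_Icc {a b : ℝ} {f : ℝ → Set ℝ} (hf : MFOn a b f) {x : ℝ}
    (hx : x ∈ Icc a b) (k : ℕ) : Iter f k x ⊆ Icc a b := by
  induction k with
  | zero =>
    rintro y rfl
    exact hx
  | succ k ih =>
    intro z hz
    obtain ⟨y, hy, hzy⟩ := mem_iUnion₂.1 hz
    exact (hf y (ih hy)).2.2 hzy

/-- If `f` is increasing and `f c` lies strictly above `c`, so do all positive iterates. -/
theorem lt_of_mem_iter_succ {a b : ℝ} {f : ℝ → Set ℝ} (hf : MFOn a b f) (hinc : SIncOn a b f)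
    {c : ℝ} (hc : c ∈ Icc a b) (h : ∀ u ∈ f c, c < u) (k : ℕ) :
    ∀ y ∈ Iter f (k + 1) c, c < y := by
  induction k with
  | zero =>
    intro z hz
    obtain ⟨y, rfl, hzy⟩ := mem_iUnion₂.1 hz
    exact h z hzy
  | succ k ih =>
    intro z hz
    obtain ⟨y, hy, hzy⟩ := mem_iUnion₂.1 hz
    obtain ⟨u, hu⟩ := (hf c hc).1
    exact (h u hu).trans (hinc c hc y (iter_subset_Icc hf hc _ hy) (ih y hy) u hu z hzy)

/-- If `f` is increasing and `f c` lies strictly below `c`, so do all positive iterates. -/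
theorem gt_of_mem_iter_succ {a b : ℝ} {f : ℝ → Set ℝ} (hf : MFOn a b f) (hinc : SIncOn a b f)
    {c : ℝ} (hc : c ∈ Icc a b) (h : ∀ u ∈ f c, u < c) (k : ℕ) :
    ∀ y ∈ Iter f (k + 1) c, y < c := by
  induction k with
  | zero =>
    intro z hz
    obtain ⟨y, rfl, hzy⟩ := mem_iUnion₂.1 hz
    exact h z hzy
  | succ k ih =>
    intro z hz
    obtain ⟨y, hy, hzy⟩ := mem_iUnion₂.1 hz
    obtain ⟨u, hu⟩ := (hf c hc).1
    exact (hinc y (iter_subset_Icc hf hc _ hy) c hc (ih y hy) z hzy u hu).trans (h u hu)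

/-- A periodic point of an increasing multifunction is a fixed point. -/
theorem mem_of_mem_iter_succ {a b : ℝ} {f : ℝ → Set ℝ} (hf : MFOn a b f) (hinc : SIncOn a b f)
    {c : ℝ} (hc : c ∈ Icc a b) {k : ℕ} (h : c ∈ Iter f (k + 1) c) : c ∈ f c := by
  by_cases hlow : ∃ u ∈ f c, u ≤ c
  · by_cases hhigh : ∃ v ∈ f c, c ≤ v
    · obtain ⟨u, hu, huc⟩ := hlow
      obtain ⟨v, hv, hcv⟩ := hhigh
      obtain ⟨y, hy, hcy⟩ := mem_iUnion₂.1 h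
      have hyI := iter_subset_Icc hf hc _ hy
      rcases lt_trichotomy y c with hlt | rfl | hgt
      · exact absurd (hinc y hyI c hc hlt c hcy u hu) huc.not_gt
      · exact hcy
      · exact absurd (hinc c hc y hyI hgt v hv c hcy) hcv.not_gt
    · push Not at hhigh
      exact absurd (gt_of_mem_iter_succ hf hinc hc hhigh k c h) (lt_irrefl c)
  · push Not at hlow
    exact absurd (lt_of_mem_iter_succ hf hinc hc hlow k c h) (lt_irrefl c)

/-- if `f ∈ 𝓕(I)` is a strictly increasing iterative root of `F ∈ 𝓕₁(I)` and
`c ∈ (a,b)` satisfies `c ∈ F(c)`, then `c ∈ f(c)`. -/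
theorem stmt9 (a b : ℝ) (hab : a < b) (F : ℝ → Set ℝ) (hF : Exclusive a b F)
    (f : ℝ → Set ℝ) (hf : ClassF a b f) (hfinc : SIncOn a b f)
    (n : ℕ) (hn : 1 ≤ n) (hroot : ∀ x ∈ Icc a b, Iter f n x = F x)
    (c : ℝ) (hc : c ∈ Ioo a b) (hcF : c ∈ F c) :
    c ∈ f c := by
  obtain ⟨k, rfl⟩ := Nat.exists_eq_add_of_le' hn
  have hcI : c ∈ Icc a b := Ioo_subset_Icc_self hc
  exact mem_of_mem_iter_succ hf.1 hfinc hcI ((hroot c hcI).symm ▸ hcF)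
end

section
/- Suppose F ∈ 𝓕₁(I) satisfies hypothesis (H). Then K := (a, c₁) is the unique subinterval in I(F) with F(K) ⊆ K, i.e. Λ(F) = {(a,c₁)}. Furthermore, if f ∈ 𝓕(I) is a strictly increasing iterative root of F of some order n ≥ 1, then (a,c₁) is also the unique subinterval J ∈ I(F) with f(J) ⊆ J. -/
open Set Filter Topology

/-- An iterate of a strictly increasing multifunction stays weakly above `x` as soon as one value
at `x` does. -/
lemma exists_mem_Iter_ge {a b : ℝ} {f : ℝ → Set ℝ} (hf : MFOn a b f) (hinc : SIncOn a b f)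
    {x u : ℝ} (hx : x ∈ Icc a b) (hu : u ∈ f x) (hxu : x ≤ u) (n : ℕ) :
    ∃ v ∈ Iter f n x, v ∈ Icc a b ∧ x ≤ v := by
  induction n with
  | zero => exact ⟨x, rfl, hx, le_rfl⟩
  | succ n ih =>
    obtain ⟨v, hv, hvI, hxv⟩ := ih
    rcases hxv.eq_or_lt with rfl | hlt
    · exact ⟨u, mem_biUnion hv hu, (hf x hx).2.2 hu, hxu⟩
    · obtain ⟨w, hw⟩ := (hf v hvI).1
      exact ⟨w, mem_biUnion hv hw, (hf v hvI).2.2 hw,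
        hxu.trans (hinc x hx v hvI hlt u hu w hw).le⟩

/-- If an iterate of `f` lies strictly below the identity at `x`, then so does `f`. -/
lemma lt_of_Iter_lt {a b : ℝ} {f : ℝ → Set ℝ} (hf : MFOn a b f) (hinc : SIncOn a b f)
    {x : ℝ} (hx : x ∈ Icc a b) {n : ℕ} (hlt : ∀ v ∈ Iter f n x, v < x) :
    ∀ u ∈ f x, u < x := by
  intro u hu
  by_contra! h
  obtain ⟨v, hv, -, hxv⟩ := exists_mem_Iter_ge hf hinc hx hu h n
  exact (hlt v hv).not_ge hxv

/-- A strictly increasing multifunction below the identity maps `(a, q)` into itself. -/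
lemma ImageOf_Ioo_left_subset {a b q : ℝ} {f : ℝ → Set ℝ} (hf : MFOn a b f)
    (hinc : SIncOn a b f) (hlt : ∀ x ∈ Ioo a b, ∀ u ∈ f x, u < x) (hab : a ≤ b) (hq : q ≤ b) :
    ImageOf f (Ioo a q) ⊆ Ioo a q := by
  refine iUnion₂_subset fun x hx u hu => ?_
  have ha : a ∈ Icc a b := left_mem_Icc.2 hab
  have hxb : x < b := hx.2.trans_le hq
  obtain ⟨w, hw⟩ := (hf a ha).1
  exact ⟨((hf a ha).2.2 hw).1.trans_lt (hinc a ha x ⟨hx.1.le, hxb.le⟩ hx.1 w hw u hu),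
    (hlt x ⟨hx.1, hxb⟩ u hu).trans hx.2⟩

/-- An upper semicontinuous multifunction lying below `p` at `p` does not map `(p, q)` into
itself. -/
lemma not_ImageOf_Ioo_subset {a b p q : ℝ} {f : ℝ → Set ℝ} (hf : MFOn a b f)
    (husc : USCWithin (Icc a b) f p) (hlt : ∀ u ∈ f p, u < p) (hp : a ≤ p) (hpq : p < q)
    (hq : q ≤ b) : ¬ ImageOf f (Ioo p q) ⊆ Ioo p q := by
  intro h
  obtain ⟨U, hU, hUf⟩ := husc (Iio p) isOpen_Iio hlt
  obtain ⟨y, hyU, hy⟩ := Filter.nonempty_of_mem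
    (inter_mem (mem_nhdsWithin_of_mem_nhds hU) (Ioo_mem_nhdsGT hpq))
  have hyI : y ∈ Icc a b := ⟨hp.trans hy.1.le, hy.2.le.trans hq⟩
  obtain ⟨w, hw⟩ := (hf y hyI).1
  have h1 : w < p := hUf y ⟨hyU, hyI⟩ hw
  exact h1.not_gt (h (mem_biUnion hy hw)).1

/-- Among consecutive intervals of a partition of `[a, b]`, a strictly increasing upper
semicontinuous multifunction below the identity leaves exactly the first one invariant. -/
lemma ImageOf_Ioo_subset_iff {a b : ℝ} {f : ℝ → Set ℝ} (hf : MFOn a b f) (husc : USCOn a b f)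
    (hinc : SIncOn a b f) (hlt : ∀ x ∈ Ioo a b, ∀ u ∈ f x, u < x) {m : ℕ} {c : ℕ → ℝ}
    (h0 : c 0 = a) (hm : c (m + 1) = b) (hc : ∀ i j : ℕ, i < j → j ≤ m + 1 → c i < c j)
    {j : ℕ} (hj : j ≤ m) :
    ImageOf f (Ioo (c j) (c (j + 1))) ⊆ Ioo (c j) (c (j + 1)) ↔ j = 0 := by
  have hle : c (j + 1) ≤ b := by
    rcases hj.eq_or_lt with rfl | h
    · exact hm.le
    · exact hm ▸ (hc (j + 1) (m + 1) (by omega) le_rfl).le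
  constructor
  · intro h
    by_contra hne
    have ha : a < c j := h0 ▸ hc 0 j (by omega) (by omega)
    have hs : c j < c (j + 1) := hc j (j + 1) (by omega) (by omega)
    have hb : c j < b := hs.trans_le hle
    exact not_ImageOf_Ioo_subset hf (husc _ ⟨ha.le, hb.le⟩) (hlt _ ⟨ha, hb⟩) ha.le hs hle h
  · rintro rfl
    have hab : a < b := h0 ▸ hm ▸ hc 0 (m + 1) (by omega) le_rfl
    rw [h0]
    exact ImageOf_Ioo_left_subset hf hinc hlt hab.le hle

/-- under hypothesis (H), `K = (a, c₁) = I_0` is the unique subinterval of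
`I(F)` with `F(K) ⊆ K`; and it is also the unique `J ∈ I(F)` with `f(J) ⊆ J` for any
strictly increasing iterative root `f ∈ 𝓕(I)` of `F`. -/
theorem stmt10 (a b : ℝ) (hab : a < b) (F : ℝ → Set ℝ) (hF : Exclusive a b F)
    (hH : HypH a b F) (m : ℕ) (c : ℕ → ℝ) (hc : JumpEnum a b F m c) :
    (∀ j ≤ m,
      (ImageOf F (Ioo (c j) (c (j + 1))) ⊆ Ioo (c j) (c (j + 1)) ↔ j = 0)) ∧
    (∀ (f : ℝ → Set ℝ) (n : ℕ), ClassF a b f → SIncOn a b f → 1 ≤ n →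
      (∀ x ∈ Icc a b, Iter f n x = F x) →
      ∀ j ≤ m,
        (ImageOf f (Ioo (c j) (c (j + 1))) ⊆ Ioo (c j) (c (j + 1)) ↔ j = 0)) := by
  obtain ⟨h0, hm, hmono, -⟩ := hc
  obtain ⟨hinc, hlt, -⟩ := hH
  refine ⟨fun j hj => ImageOf_Ioo_subset_iff hF.1.1 hF.1.2.1 hinc hlt h0 hm hmono hj, ?_⟩
  intro f n hf hfinc _ hroot j hj
  refine ImageOf_Ioo_subset_iff hf.1 hf.2.1 hfinc (fun x hx => ?_) h0 hm hmono hj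
  have hxI := Ioo_subset_Icc_self hx
  exact lt_of_Iter_lt hf.1 hfinc hxI (n := n) (hroot x hxI ▸ hlt x hx)
end

section
/- Suppose F ∈ 𝓕₁(I) satisfies hypothesis (H), c_i ∈ J(F) satisfies J(F) ∩ F(c_i) = {c_i} (case J2), and F(c_i) is a compact interval. Let f_* : I ∖ J(F) → I ∖ J(F) be a strictly increasing continuous single-valued function with f_*^n(x) = F(x) (a singleton) for all x ∈ I ∖ J(F). Then the multifunction f defined by f(x) = {f_*(x)} for x ∈ I ∖ J(F) and f(c_i) = [lim_{s→c_i⁻} f_*(s), c_i] is a strictly increasing upper semi-continuous iterative root of F of order n on (I ∖ J(F)) ∪ {c_i}; in particular f^n(c_i) = [lim_{s→c_i⁻} F(s), c_i] = F(c_i). -/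
open Set Filter Topology

/-- Under (H), values of `F` at points of `[a,b)` lie weakly below the point, also at `a`. -/
lemma HypH.le_of_mem {a b : ℝ} {F : ℝ → Set ℝ} (hab : a < b) (hMF : MFOn a b F)
    (hH : HypH a b F) {x u : ℝ} (hx : x ∈ Ico a b) (hu : u ∈ F x) : u ≤ x := by
  rcases hx.1.eq_or_lt with rfl | hax
  · by_contra! hlt
    have hub : u ≤ b := ((hMF a ⟨le_rfl, hab.le⟩).2.2 hu).2
    have hy : (a + u) / 2 ∈ Ioo a b := ⟨by linarith, by linarith⟩
    obtain ⟨v, hv⟩ := (hMF _ (Ioo_subset_Icc_self hy)).1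
    have h1 := hH.2.1 _ hy v hv
    have h2 := hH.1 a ⟨le_rfl, hab.le⟩ _ (Ioo_subset_Icc_self hy) hy.1 u hu v hv
    linarith
  · exact (hH.2.1 x ⟨hax, hx.2⟩ u hu).le

/-- Under (H), the only jump of `F` that can belong to its own image is the right endpoint. -/
lemma HypH.eq_right_of_mem_self {a b c : ℝ} {F : ℝ → Set ℝ} (hab : a < b) (hMF : MFOn a b F)
    (hH : HypH a b F) (hc : c ∈ Jumps a b F) (hcF : c ∈ F c) : c = b := by
  by_contra hne
  have hcb : c < b := lt_of_le_of_ne hc.1.2 hne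
  rcases hc.1.1.eq_or_lt with rfl | hac
  · refine hc.2.not_subsingleton fun u hu v hv => ?_
    have hval : ∀ w ∈ F a, w = a := fun w hw =>
      le_antisymm (hH.le_of_mem hab hMF ⟨le_rfl, hcb⟩ hw) ((hMF a hc.1).2.2 hw).1
    rw [hval u hu, hval v hv]
  · exact lt_irrefl c (hH.2.1 c ⟨hac, hcb⟩ c hcF)

/-- A monotone self-map whose positive iterate lies weakly below the identity does so itself. -/
lemma apply_le_of_iterate_le {D : Set ℝ} {g : ℝ → ℝ} (hmaps : MapsTo g D D)
    (hmono : StrictMonoOn g D) {x : ℝ} (hx : x ∈ D) (N : ℕ) (h : g^[N + 1] x ≤ x) :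
    g x ≤ x := by
  by_contra! hlt
  have key : ∀ k, x < g^[k + 1] x := by
    intro k
    induction k with
    | zero => simpa using hlt
    | succ k ih =>
      rw [Function.iterate_succ_apply']
      exact hlt.trans (hmono hx (hmaps.iterate _ hx) ih)
  exact absurd (key N) h.not_gt

lemma iterate_le_of_apply_le {D : Set ℝ} {g : ℝ → ℝ} (hmaps : MapsTo g D D)
    (hle : ∀ x ∈ D, g x ≤ x) (k : ℕ) {x : ℝ} (hx : x ∈ D) : g^[k] x ≤ x := by
  induction k with
  | zero => simp
  | succ k ih =>
    rw [Function.iterate_succ_apply']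
    exact (hle _ (hmaps.iterate k hx)).trans ih

/-- Where a multifunction is single-valued on an invariant set, so are its iterates. -/
lemma Iter_eq_singleton {D : Set ℝ} {g : ℝ → ℝ} {f : ℝ → Set ℝ} (hmaps : MapsTo g D D)
    (hf : ∀ x ∈ D, f x = {g x}) (k : ℕ) {x : ℝ} (hx : x ∈ D) : Iter f k x = {g^[k] x} := by
  induction k with
  | zero => rfl
  | succ k ih =>
    have hk := hf _ (hmaps.iterate k hx)
    simp only [Iter, ih, biUnion_singleton, hk, Function.iterate_succ_apply']

/-- A strictly monotone function lies strictly below its left limit at `b`. -/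
lemma StrictMonoOn.lt_leftLim {D : Set ℝ} {g : ℝ → ℝ} {b L : ℝ} (hmono : StrictMonoOn g D)
    (hD : ∀ᶠ s in 𝓝[<] b, s ∈ D) (hL : Tendsto g (𝓝[<] b) (𝓝 L)) {x : ℝ} (hx : x ∈ D)
    (hxb : x < b) : g x < L := by
  obtain ⟨y, hy, hyI⟩ := (hD.and (Ioo_mem_nhdsLT hxb)).exists
  refine (hmono hx hy hyI.1).trans_le (ge_of_tendsto hL ?_)
  filter_upwards [hD, Ioo_mem_nhdsLT hyI.2] with z hz hzI
  exact (hmono hy hz hzI.1).le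

/-- Image of `[l, b]` under a multifunction with values `{g x}` on `[l, b)` and `[L, b]` at `b`,
where `L` is the left limit of `g` at `b`. -/
lemma biUnion_Icc_eq_Icc {D : Set ℝ} {g : ℝ → ℝ} {f : ℝ → Set ℝ} {b l L : ℝ} (hlb : l < b)
    (hD : Ico l b ⊆ D) (hmono : StrictMonoOn g D) (hcont : ContinuousOn g D)
    (hle : ∀ x ∈ D, g x ≤ x) (hL : Tendsto g (𝓝[<] b) (𝓝 L)) (hf : ∀ x ∈ D, f x = {g x})
    (hfb : f b = Icc L b) : ⋃ y ∈ Icc l b, f y = Icc (g l) b := by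
  have hl : l ∈ D := hD ⟨le_rfl, hlb⟩
  have hev : ∀ᶠ s in 𝓝[<] b, s ∈ D := by
    filter_upwards [Ioo_mem_nhdsLT hlb] with s hs using hD ⟨hs.1.le, hs.2⟩
  have hlL : g l < L := hmono.lt_leftLim hev hL hl hlb
  ext u
  simp only [mem_iUnion, exists_prop]
  constructor
  · rintro ⟨y, hy, hu⟩
    rcases hy.2.eq_or_lt with rfl | hyb
    · rw [hfb] at hu
      exact ⟨hlL.le.trans hu.1, hu.2⟩
    · have hyD : y ∈ D := hD ⟨hy.1, hyb⟩
      rw [hf y hyD, mem_singleton_iff] at hu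
      subst hu
      exact ⟨hmono.monotoneOn hl hyD hy.1, (hle y hyD).trans hy.2⟩
  · intro hu
    rcases le_or_gt L u with hLu | huL
    · exact ⟨b, ⟨hlb.le, le_rfl⟩, by rw [hfb]; exact ⟨hLu, hu.2⟩⟩
    · obtain ⟨s, hus, hs⟩ := ((hL.eventually_const_lt huL).and (Ioo_mem_nhdsLT hlb)).exists
      have hsub : Icc l s ⊆ D := fun z hz => hD ⟨hz.1, hz.2.trans_lt hs.2⟩
      obtain ⟨y, hy, rfl⟩ :=
        intermediate_value_Icc hs.1.le (hcont.mono hsub) ⟨hu.1, hus.le⟩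
      exact ⟨y, ⟨hy.1, hy.2.trans hs.2.le⟩, by rw [hf y (hsub hy)]; rfl⟩

/-- case (J2) with `F(cᵢ)` a compact interval.  If `f_*` is a strictly
increasing continuous `n`-th order iterative root of `F` on `I ∖ J(F)`, then setting
`f = f_*` off the jumps and `f(cᵢ) = [lim_{s→cᵢ⁻} f_*(s), cᵢ]` yields a strictly increasing
usc iterative root of `F` of order `n` on `(I ∖ J(F)) ∪ {cᵢ}`; in particular
`f^n(cᵢ) = [lim_{s→cᵢ⁻} F(s), cᵢ] = F(cᵢ)`. -/
theorem stmt13 (a b : ℝ) (hab : a < b) (F : ℝ → Set ℝ) (hF : Exclusive a b F)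
    (hH : HypH a b F)
    (ci : ℝ) (hci : ci ∈ Jumps a b F) (hJ2 : Jumps a b F ∩ F ci = {ci})
    (hcpt : ∃ p q : ℝ, p ≤ q ∧ F ci = Icc p q)
    (n : ℕ) (hn : 1 ≤ n) (fs : ℝ → ℝ)
    (hmaps : MapsTo fs (Icc a b \ Jumps a b F) (Icc a b \ Jumps a b F))
    (hmono : StrictMonoOn fs (Icc a b \ Jumps a b F))
    (hcont : ContinuousOn fs (Icc a b \ Jumps a b F))
    (hroot : ∀ x ∈ Icc a b \ Jumps a b F, F x = {fs^[n] x})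
    (L : ℝ) (hL : Tendsto fs (𝓝[(Icc a b \ Jumps a b F) ∩ Iio ci] ci) (𝓝 L))
    (M : ℝ)
    (hM : Tendsto (fun s => fs^[n] s) (𝓝[(Icc a b \ Jumps a b F) ∩ Iio ci] ci) (𝓝 M))
    (f : ℝ → Set ℝ)
    (hfdef : ∀ x ∈ Icc a b \ Jumps a b F, f x = {fs x})
    (hfci : f ci = Icc L ci) :
    (∀ x ∈ insert ci (Icc a b \ Jumps a b F), Iter f n x = F x) ∧
    (∀ x ∈ insert ci (Icc a b \ Jumps a b F),
      ∀ y ∈ insert ci (Icc a b \ Jumps a b F),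
        x < y → ∀ u ∈ f x, ∀ v ∈ f y, u < v) ∧
    (∀ x ∈ insert ci (Icc a b \ Jumps a b F),
      USCWithin (insert ci (Icc a b \ Jumps a b F)) f x) ∧
    Iter f n ci = Icc M ci ∧ Icc M ci = F ci := by
  obtain ⟨⟨hMF, hUSC, -⟩, -, -⟩ := hF
  have hciF : ci ∈ F ci := (hJ2.ge (mem_singleton ci)).2
  obtain rfl : ci = b := hH.eq_right_of_mem_self hab hMF hci hciF
  obtain ⟨p, q, hpq, hFb⟩ := hcpt
  obtain rfl : q = ci := le_antisymm (hH.2.2 q (by rw [hFb]; exact ⟨hpq, le_rfl⟩))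
    (by rw [hFb] at hciF; exact hciF.2)
  have hpF : p ∈ F q := by rw [hFb]; exact ⟨le_rfl, hpq⟩
  have hap : a ≤ p := ((hMF q hci.1).2.2 hpF).1
  have hpb : p < q := by
    refine lt_of_le_of_ne hpq ?_
    rintro rfl
    refine hci.2.not_subsingleton ?_
    rw [hFb, Icc_self]
    exact subsingleton_singleton
  set D := Icc a q \ Jumps a q F with hDdef
  have hpD : Ico p q ⊆ D := fun x hx => ⟨⟨hap.trans hx.1, hx.2.le⟩, fun hxJ =>
    hx.2.ne (hJ2.le ⟨hxJ, by rw [hFb]; exact ⟨hx.1, hx.2.le⟩⟩)⟩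
  have hDlt : ∀ x ∈ D, x < q := fun x hx =>
    lt_of_le_of_ne hx.1.2 (by rintro rfl; exact hx.2 hci)
  have hev : ∀ᶠ s in 𝓝[<] q, s ∈ D := by
    filter_upwards [Ioo_mem_nhdsLT hpb] with s hs using hpD ⟨hs.1.le, hs.2⟩
  have hfilter : 𝓝[D ∩ Iio q] q = 𝓝[<] q :=
    le_antisymm (nhdsWithin_mono _ inter_subset_right)
      (nhdsWithin_le_of_mem (inter_mem hev self_mem_nhdsWithin))
  rw [hfilter] at hL hM
  obtain ⟨N, rfl⟩ : ∃ N, n = N + 1 := ⟨n - 1, by omega⟩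
  have hmemF : ∀ x ∈ D, fs^[N + 1] x ∈ F x := fun x hx => by rw [hroot x hx]; rfl
  have hle : ∀ x ∈ D, fs x ≤ x := fun x hx => apply_le_of_iterate_le hmaps hmono hx N
    (hH.le_of_mem hab hMF ⟨hx.1.1, hDlt x hx⟩ (hmemF x hx))
  -- The left limit of `F` at the jump is the left end of its value there.
  obtain rfl : M = p := by
    apply le_antisymm
    · refine le_of_tendsto hM ?_
      filter_upwards [hev] with s hs
      exact (hH.1 s hs.1 q hci.1 (hDlt s hs) _ (hmemF s hs) p hpF).le
    · refine le_of_forall_lt fun r hr => ?_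
      obtain ⟨r', hrr', hr'⟩ := exists_between hr
      obtain ⟨U, hU, hUV⟩ := hUSC q hci.1 (Ioi r') isOpen_Ioi (by
        rw [hFb]; exact fun z hz => hr'.trans_le hz.1)
      refine hrr'.trans_le (ge_of_tendsto hM ?_)
      filter_upwards [hev, mem_nhdsWithin_of_mem_nhds hU] with s hs hsU
      exact (hUV s ⟨hsU, hs.1⟩ (hmemF s hs)).le
  have hltL : ∀ x ∈ D, fs x < L := fun x hx => hmono.lt_leftLim hev hL hx (hDlt x hx)
  have hML : M ≤ L := by
    refine le_of_tendsto_of_tendsto hM hL ?_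
    filter_upwards [hev] with s hs
    exact iterate_le_of_apply_le hmaps hle N (hmaps hs)
  have hLb : L < q := by
    have hLle : L ≤ q := by
      refine le_of_tendsto hL ?_
      filter_upwards [hev] with s hs using (hDlt _ (hmaps hs)).le
    refine lt_of_le_of_ne hLle ?_
    rintro rfl
    have hself : Tendsto fs (𝓝[<] L) (𝓝[<] L) :=
      tendsto_nhdsWithin_iff.2 ⟨hL, by filter_upwards [hev] with s hs using hltL s hs⟩
    exact hpb.ne (tendsto_nhds_unique hM ((hself.iterate (N + 1)).mono_right nhdsWithin_le_nhds))
  have hLD : L ∈ D := hpD ⟨hML, hLb⟩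
  have hMeq : fs^[N] L = M := by
    refine tendsto_nhds_unique (Tendsto.comp (hcont.iterate hmaps N L hLD)
      (tendsto_nhdsWithin_iff.2 ⟨hL, ?_⟩)) hM
    filter_upwards [hev] with s hs using hmaps hs
  have hiter : ∀ k ≤ N, Iter f (k + 1) q = Icc (fs^[k] L) q := by
    intro k
    induction k with
    | zero => intro _; simp [Iter, hfci]
    | succ k ih =>
      intro hk
      have hkD : fs^[k] L ∈ D := hmaps.iterate k hLD
      have hMk : M ≤ fs^[k] L := by
        have h := iterate_le_of_apply_le hmaps hle (N - k) hkD
        rwa [← Function.iterate_add_apply, Nat.sub_add_cancel (by omega), hMeq] at h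
      have hstep := biUnion_Icc_eq_Icc (hDlt _ hkD)
        (fun z hz => hpD ⟨hMk.trans hz.1, hz.2⟩) hmono hcont hle hL hfdef hfci
      rw [Function.iterate_succ_apply', ← hstep, ← ih (by omega)]
      rfl
  have hIq : Iter f (N + 1) q = Icc M q := by rw [hiter N le_rfl, hMeq]
  refine ⟨?_, ?_, ?_, hIq, hFb.symm⟩
  · rintro x (rfl | hx)
    · rw [hIq, hFb]
    · rw [Iter_eq_singleton hmaps hfdef _ hx, hroot x hx]
  · rintro x (rfl | hx) y (rfl | hy) hxy u hu v hv
    · exact absurd hxy (lt_irrefl _)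
    · exact absurd hxy (hDlt y hy).not_gt
    · rw [hfdef x hx, mem_singleton_iff] at hu
      rw [hfci] at hv
      exact hu ▸ (hltL x hx).trans_le hv.1
    · rw [hfdef x hx, mem_singleton_iff] at hu
      rw [hfdef y hy, mem_singleton_iff] at hv
      exact hu ▸ hv ▸ hmono hx hy hxy
  · rintro x (rfl | hx) V hV hfV
    · rw [hfci] at hfV
      have hLV := hL.eventually (hV.mem_nhds (hfV ⟨le_rfl, hLb.le⟩))
      refine ⟨_, eventually_nhdsWithin_iff.1 hLV, ?_⟩
      rintro y ⟨hyU, rfl | hy⟩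
      · rwa [hfci]
      · rw [hfdef y hy, singleton_subset_iff]
        exact hyU (hDlt y hy)
    · rw [hfdef x hx, singleton_subset_iff] at hfV
      have hxV := (hcont x hx).eventually (hV.mem_nhds hfV)
      refine ⟨_, inter_mem (eventually_nhdsWithin_iff.1 hxV) (Iio_mem_nhds (hDlt x hx)), ?_⟩
      rintro y ⟨⟨hyU, hyq⟩, rfl | hy⟩
      · exact absurd (mem_Iio.1 hyq) (lt_irrefl _)
      · rw [hfdef y hy, singleton_subset_iff]
        exact hyU hy
end
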